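/- Let c ≥ 1 and d ≥ 3 be integers, let H = K_d, and let ℓ ≥ 1 be an integer. Then there exists a bound N (depending only on c, d and ℓ) such that for every (0,d)-regular relation R ⊆ {0,...,c}^ℓ there exists a (c,H)-coherent gadget G with ℓ portal vertices that strictly (c,H)-realizes R and satisfies |V(G)| ≤ N. -/

import Mathlib

/-! Framework: copies of `H`, (c,H)-packings and partitions, gadgets,
coherence, and realization of relations, following the paper's definitions. -/

open scoped Classical

/-- Number of members of the multiset `P` of subgraphs of `G` containing `v`. -/
noncomputable def coverM {V : Type} {G : SimpleGraph V} (P : Multiset G.Subgraph) (v : V) : ℕ :=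
  (P.map fun Z => if v ∈ Z.verts then 1 else 0).sum

/-- Number of members of the finite set `P` of subgraphs of `G` containing `v`. -/
noncomputable def coverF {V : Type} {G : SimpleGraph V} (P : Finset G.Subgraph) (v : V) : ℕ :=
  coverM P.val v

/-- `Z` is a copy of `H`, i.e. a subgraph of `G` isomorphic to `H`. -/
def IsCopy {α V : Type} (H : SimpleGraph α) {G : SimpleGraph V} (Z : G.Subgraph) : Prop :=
  Nonempty (Z.coe ≃g H)

/-- An arbitrary `(c,H)`-partition: a multiset of copies of `H` in `G` covering
every vertex exactly `c` times. -/
def IsArbPartition {α V : Type} (H : SimpleGraph α) (c : ℕ) {G : SimpleGraph V}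
    (P : Multiset G.Subgraph) : Prop :=
  (∀ Z ∈ P, IsCopy H Z) ∧ ∀ v : V, coverM P v = c

/-- A distinct `(c,H)`-partition: a set of copies of `H` in `G` covering
every vertex exactly `c` times. -/
def IsDistPartition {α V : Type} (H : SimpleGraph α) (c : ℕ) {G : SimpleGraph V}
    (P : Finset G.Subgraph) : Prop :=
  (∀ Z ∈ P, IsCopy H Z) ∧ ∀ v : V, coverF P v = c

/-- The gadget `G` with portal vertices `portals` is `(c,H)`-coherent: in every
extension `E` of `G` (given by an induced embedding `ι` such that internal vertices
keep all their neighbours inside the gadget), every member of an arbitrary-or-distinct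
`(c,H)`-partition of `E` containing an internal vertex of the gadget lies entirely
inside the gadget. -/
def Coherent {α V : Type} (H : SimpleGraph α) (c : ℕ) {ℓ : ℕ}
    (G : SimpleGraph V) (portals : Fin ℓ → V) : Prop :=
  ∀ (W : Type) (E : SimpleGraph W) (ι : V → W),
    Function.Injective ι →
    (∀ a b : V, E.Adj (ι a) (ι b) ↔ G.Adj a b) →
    (∀ v : V, v ∉ Set.range portals → ∀ w : W, E.Adj (ι v) w → w ∈ Set.range ι) →
    ∀ P : Multiset E.Subgraph, IsArbPartition H c P →
      ∀ Z ∈ P, (∃ v : V, v ∉ Set.range portals ∧ ι v ∈ Z.verts) →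
        Z.verts ⊆ Set.range ι

/-- The gadget `(G, portals)` dist-`(c,H)`-realizes the relation `R ⊆ {0,…,c}^ℓ`. -/
def DistRealizes {α V : Type} (H : SimpleGraph α) (c : ℕ) {ℓ : ℕ}
    (G : SimpleGraph V) (portals : Fin ℓ → V) (R : Set (Fin ℓ → ℕ)) : Prop :=
  ∀ r : Fin ℓ → ℕ, (∀ i, r i ≤ c) →
    (r ∈ R ↔ ∃ P : Finset G.Subgraph,
      (∀ Z ∈ P, IsCopy H Z) ∧
      (∀ v : V, coverF P v ≤ c) ∧
      (∀ v : V, v ∉ Set.range portals → coverF P v = c) ∧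
      (∀ i : Fin ℓ, coverF P (portals i) = r i))

/-- The gadget `(G, portals)` arb-`(c,H)`-realizes the relation `R ⊆ {0,…,c}^ℓ`. -/
def ArbRealizes {α V : Type} (H : SimpleGraph α) (c : ℕ) {ℓ : ℕ}
    (G : SimpleGraph V) (portals : Fin ℓ → V) (R : Set (Fin ℓ → ℕ)) : Prop :=
  ∀ r : Fin ℓ → ℕ, (∀ i, r i ≤ c) →
    (r ∈ R ↔ ∃ P : Multiset G.Subgraph,
      (∀ Z ∈ P, IsCopy H Z) ∧
      (∀ v : V, coverM P v ≤ c) ∧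
      (∀ v : V, v ∉ Set.range portals → coverM P v = c) ∧
      (∀ i : Fin ℓ, coverM P (portals i) = r i))

/-- Strict realization: both dist- and arb-realization. -/
def StrictRealizes {α V : Type} (H : SimpleGraph α) (c : ℕ) {ℓ : ℕ}
    (G : SimpleGraph V) (portals : Fin ℓ → V) (R : Set (Fin ℓ → ℕ)) : Prop :=
  DistRealizes H c G portals R ∧ ArbRealizes H c G portals R

/-- The relation NEQ_c = {(x, c−x) : 0 ≤ x ≤ c}. -/
def NEQrel (c : ℕ) : Set (Fin 2 → ℕ) := {r | ∃ x ≤ c, r 0 = x ∧ r 1 = c - x}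

/-- How often a vertex `u` is covered when each edge `e` of the hypergraph `inc` is taken
`w e` times. -/
noncomputable def weightAt {d : ℕ} {U E : Type} [Fintype E] (inc : E → Fin d → U) (w : E → ℕ) (u : U) : ℕ :=
  ∑ e, ∑ k, if inc e k = u then w e else 0

/-- The vertices of the blow-up of a `d`-uniform hypergraph: every hyperedge `e` becomes `d` colour
classes indexed by the field `F`, where the class `k` has the `k`-th vertex of `e` at position `0`
and private vertices at all other positions. -/
abbrev BlowupVert (d : ℕ) (U E F : Type) [Zero F] : Type :=
  U ⊕ (E × Fin d × {a : F // a ≠ 0})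

section Blowup

variable {d : ℕ} {U E F : Type} [Field F] (inc : E → Fin d → U)

/-- The vertex at position `a` of the colour class `k` in the blow-up of the hyperedge `e`. -/
noncomputable def blowupVert (e : E) (k : Fin d) (a : F) : BlowupVert d U E F :=
  if h : a = 0 then Sum.inl (inc e k) else Sum.inr (e, k, ⟨a, h⟩)

/-- The blow-up graph: each hyperedge becomes a complete `d`-partite graph, except that the original
vertices stay pairwise non-adjacent. -/
def blowup (F : Type) [Field F] (inc : E → Fin d → U) : SimpleGraph (BlowupVert d U E F) where
  Adj u v := ∃ e k a k' a', k ≠ k' ∧ (a ≠ 0 ∨ a' ≠ 0) ∧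
    u = blowupVert inc e k a ∧ v = blowupVert inc e k' a'
  symm := ⟨fun u v ⟨e, k, a, k', a', h, h', hu, hv⟩ => ⟨e, k', a', k, a, h.symm, h'.symm, hv, hu⟩⟩
  loopless := ⟨by
    rintro u ⟨e, k, a, k', a', h, h', hu, hv⟩
    rw [hu] at hv
    unfold blowupVert at hv
    split_ifs at hv <;> simp_all⟩

@[simp] lemma blowupVert_zero (e : E) (k : Fin d) :
    blowupVert inc e k (0 : F) = Sum.inl (inc e k) := by simp [blowupVert]

lemma blowupVert_of_ne (e : E) (k : Fin d) {a : F} (h : a ≠ 0) :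
    blowupVert inc e k a = Sum.inr (e, k, ⟨a, h⟩) := by simp [blowupVert, h]

lemma blowupVert_eq_inr {e : E} {k : Fin d} {a : F} {x : E × Fin d × {a : F // a ≠ 0}} :
    blowupVert inc e k a = Sum.inr x ↔ e = x.1 ∧ k = x.2.1 ∧ a = x.2.2 := by
  obtain ⟨e', k', a', ha'⟩ := x
  unfold blowupVert
  split_ifs with h
  · subst h; simp [ha'.symm]
  · simp

lemma blowupVert_eq_inl {e : E} {k : Fin d} {a : F} {u : U} :
    blowupVert inc e k a = Sum.inl u ↔ a = 0 ∧ inc e k = u := by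
  unfold blowupVert
  split_ifs with h <;> simp [h]

variable {inc}

lemma blowupVert_inj (hinc : ∀ e, Function.Injective (inc e)) {e : E} {k k' : Fin d} {a a' : F}
    (h : blowupVert inc e k a = blowupVert inc e k' a') : k = k' ∧ a = a' := by
  by_cases h' : a' = 0
  · subst h'
    rw [blowupVert_zero, blowupVert_eq_inl] at h
    exact ⟨hinc e h.2, h.1⟩
  · rw [blowupVert_of_ne inc e k' h', blowupVert_eq_inr] at h
    exact h.2

/-- The neighbours of a private vertex lie in the blow-up of the same hyperedge, in another colour
class. -/
lemma exists_of_adj_inr {x : E × Fin d × {a : F // a ≠ 0}} {v : BlowupVert d U E F}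
    (h : (blowup F inc).Adj (Sum.inr x) v) : ∃ k a, k ≠ x.2.1 ∧ v = blowupVert inc x.1 k a := by
  obtain ⟨e, k, a, k', a', hk, -, hu, hv⟩ := h
  obtain ⟨rfl, rfl, -⟩ := (blowupVert_eq_inr inc).1 hu.symm
  exact ⟨k', a', hk.symm, hv⟩

lemma exists_inr_of_adj {u v : BlowupVert d U E F} (h : (blowup F inc).Adj u v) :
    ∃ x, u = Sum.inr x ∨ v = Sum.inr x := by
  obtain ⟨e, k, a, k', a', hk, h, hu, hv⟩ := h
  rcases h with h | h
  · exact ⟨_, Or.inl (hu.trans (blowupVert_of_ne inc e k h))⟩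
  · exact ⟨_, Or.inr (hv.trans (blowupVert_of_ne inc e k' h))⟩

lemma color_ne_of_adj (hinc : ∀ e, Function.Injective (inc e)) {e : E} {k k' : Fin d} {a a' : F}
    (h : (blowup F inc).Adj (blowupVert inc e k a) (blowupVert inc e k' a')) : k ≠ k' := by
  by_cases ha : a = 0
  · by_cases ha' : a' = 0
    · subst ha ha'
      obtain ⟨x, hx⟩ := exists_inr_of_adj h
      simp at hx
    · rw [blowupVert_of_ne inc e k' ha'] at h
      obtain ⟨k₁, a₁, hk, hv⟩ := exists_of_adj_inr h.symm
      rw [(blowupVert_inj hinc hv).1]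
      exact hk
  · rw [blowupVert_of_ne inc e k ha] at h
    obtain ⟨k₁, a₁, hk, hv⟩ := exists_of_adj_inr h
    rw [(blowupVert_inj hinc hv).1]
    exact hk.symm

lemma IsCopy.adj {V : Type} {G : SimpleGraph V} {Z : G.Subgraph}
    (hZ : IsCopy (⊤ : SimpleGraph (Fin d)) Z) {u v : V} (hu : u ∈ Z.verts) (hv : v ∈ Z.verts)
    (h : u ≠ v) : G.Adj u v := by
  obtain ⟨f⟩ := hZ
  have : Z.coe.Adj ⟨u, hu⟩ ⟨v, hv⟩ := by
    rw [← f.map_adj_iff]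
    simpa using h
  exact Z.adj_sub this

/-- The subgraph `Z` of the blow-up uses a private vertex of the hyperedge `e`. -/
def UsesEdge (Z : (blowup F inc).Subgraph) (e : E) : Prop :=
  ∃ k a, (Sum.inr (e, k, a) : BlowupVert d U E F) ∈ Z.verts

lemma UsesEdge.mem_blowupVert {Z : (blowup F inc).Subgraph} {e : E}
    (hZ : IsCopy (⊤ : SimpleGraph (Fin d)) Z) (he : UsesEdge Z e) {v : BlowupVert d U E F}
    (hv : v ∈ Z.verts) : ∃ k a, v = blowupVert inc e k a := by
  obtain ⟨k, a, ha⟩ := he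
  by_cases h : v = Sum.inr (e, k, a)
  · exact ⟨k, a, by rw [h, blowupVert_of_ne inc e k a.2]⟩
  · obtain ⟨k', a', -, h'⟩ := exists_of_adj_inr (hZ.adj ha hv (Ne.symm h))
    exact ⟨k', a', h'⟩

lemma UsesEdge.eq {Z : (blowup F inc).Subgraph} {e e' : E}
    (hZ : IsCopy (⊤ : SimpleGraph (Fin d)) Z) (he : UsesEdge Z e) (he' : UsesEdge Z e') :
    e = e' := by
  obtain ⟨k, a, ha⟩ := he'
  obtain ⟨k', a', h⟩ := he.mem_blowupVert hZ ha
  exact ((blowupVert_eq_inr inc).1 h.symm).1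

lemma exists_usesEdge (hd : 2 ≤ d) {Z : (blowup F inc).Subgraph}
    (hZ : IsCopy (⊤ : SimpleGraph (Fin d)) Z) : ∃ e, UsesEdge Z e := by
  have hZ' := hZ
  obtain ⟨f⟩ := hZ'
  let i : Fin d := ⟨0, by omega⟩
  let j : Fin d := ⟨1, by omega⟩
  have hij : (f.symm i : BlowupVert d U E F) ≠ f.symm j := by
    intro h
    have := f.symm.injective (Subtype.ext h)
    simp [i, j] at this
  obtain ⟨⟨e, k, a⟩, hx⟩ := exists_inr_of_adj (hZ.adj (f.symm i).2 (f.symm j).2 hij)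
  rcases hx with hx | hx
  · exact ⟨e, k, a, hx ▸ (f.symm i).2⟩
  · exact ⟨e, k, a, hx ▸ (f.symm j).2⟩

/-- A copy of `K_d` meets each colour class of the blow-up of its hyperedge exactly once. -/
lemma UsesEdge.existsUnique_mem (hinc : ∀ e, Function.Injective (inc e))
    {Z : (blowup F inc).Subgraph} {e : E} (hZ : IsCopy (⊤ : SimpleGraph (Fin d)) Z)
    (he : UsesEdge Z e) (k : Fin d) : ∃! a : F, blowupVert inc e k a ∈ Z.verts := by
  have hZ' := hZ
  obtain ⟨f⟩ := hZ'
  choose g a hg using fun i => he.mem_blowupVert hZ (f.symm i).2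
  have hinj : Function.Injective g := by
    intro i j hij
    by_contra hne
    have hne' : (f.symm i : BlowupVert d U E F) ≠ f.symm j := fun h =>
      hne (f.symm.injective (Subtype.ext h))
    have hadj := hZ.adj (f.symm i).2 (f.symm j).2 hne'
    rw [hg, hg] at hadj
    exact color_ne_of_adj hinc hadj hij
  obtain ⟨i, rfl⟩ := Finite.surjective_of_injective hinj k
  refine ⟨a i, by simpa [hg] using (f.symm i).2, fun b hb => ?_⟩
  by_contra hne
  have hmem : blowupVert inc e (g i) (a i) ∈ Z.verts := hg i ▸ (f.symm i).2
  exact color_ne_of_adj hinc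
    (hZ.adj hb hmem fun h => hne (blowupVert_inj hinc h).2) rfl

lemma Multiset.sum_map_finset_sum {ι κ : Type*} (P : Multiset ι) (s : Finset κ) (f : ι → κ → ℕ) :
    (P.map fun Z => ∑ x ∈ s, f Z x).sum = ∑ x ∈ s, (P.map fun Z => f Z x).sum := by
  induction P using Multiset.induction_on with
  | empty => simp
  | cons Z P ih => simp [ih, Finset.sum_add_distrib]

/-- The cover of the original vertices by a packing that covers all private vertices exactly `c`
times comes from a weighting of the hyperedges. -/
lemma exists_weight_of_packing [Fintype E] [Fintype F] (hd : 2 ≤ d)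
    (hinc : ∀ e, Function.Injective (inc e)) {c : ℕ} (P : Multiset (blowup F inc).Subgraph)
    (hP : ∀ Z ∈ P, IsCopy (⊤ : SimpleGraph (Fin d)) Z)
    (hc : ∀ x, coverM P (Sum.inr x) = c) :
    ∃ w : E → ℕ, ∀ u, coverM P (Sum.inl u) = weightAt inc w u := by
  let n : E → ℕ := fun e => (P.map fun Z => if UsesEdge Z e then 1 else 0).sum
  let q : E → Fin d → ℕ := fun e k => (P.map fun Z =>
    if UsesEdge Z e ∧ Sum.inl (inc e k) ∈ Z.verts then 1 else 0).sum
  have hn : ∀ e k, n e = q e k + c * Fintype.card {a : F // a ≠ 0} := by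
    intro e k
    have h1 : c * Fintype.card {a : F // a ≠ 0} = (P.map fun Z => ∑ a : {a : F // a ≠ 0},
        if (Sum.inr (e, k, a) : BlowupVert d U E F) ∈ Z.verts then 1 else 0).sum := by
      rw [Multiset.sum_map_finset_sum]
      have : ∀ a : {a : F // a ≠ 0}, (P.map fun Z =>
        if (Sum.inr (e, k, a) : BlowupVert d U E F) ∈ Z.verts then 1 else 0).sum = c :=
        fun a => hc (e, k, a)
      simp [this, mul_comm]
    rw [h1, ← Multiset.sum_map_add]
    refine congrArg Multiset.sum (Multiset.map_congr rfl fun Z hZ => ?_)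
    by_cases he : UsesEdge Z e
    · obtain ⟨a, ha, huniq⟩ := he.existsUnique_mem hinc (hP Z hZ) k
      replace huniq : ∀ b, blowupVert inc e k b ∈ Z.verts → b = a := huniq
      by_cases h0 : a = 0
      · subst h0
        have hz : ∀ b : {a : F // a ≠ 0},
            (Sum.inr (e, k, b) : BlowupVert d U E F) ∉ Z.verts := fun b hb =>
          b.2 (huniq b (by rwa [blowupVert_of_ne inc e k b.2]))
        rw [blowupVert_zero] at ha
        simp [he, ha, hz]
      · have hz : (Sum.inl (inc e k) : BlowupVert d U E F) ∉ Z.verts := fun hb =>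
          h0 (huniq 0 (by rwa [blowupVert_zero])).symm
        have hb : ∀ b : {a : F // a ≠ 0},
            (Sum.inr (e, k, b) : BlowupVert d U E F) ∈ Z.verts ↔ b = ⟨a, h0⟩ := by
          intro b
          constructor
          · exact fun hb => Subtype.ext (huniq b (by rwa [blowupVert_of_ne inc e k b.2]))
          · rintro rfl
            rwa [blowupVert_of_ne inc e k h0] at ha
        simp [he, hz, hb]
    · have hz : ∀ b : {a : F // a ≠ 0},
            (Sum.inr (e, k, b) : BlowupVert d U E F) ∉ Z.verts := fun b hb => he ⟨k, b, hb⟩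
      simp [he, hz]
  refine ⟨fun e => n e - c * Fintype.card {a : F // a ≠ 0}, fun u => ?_⟩
  have hq : ∀ e k, n e - c * Fintype.card {a : F // a ≠ 0} = q e k := fun e k => by
    rw [hn e k]; omega
  have hcov : coverM P (Sum.inl u) = (P.map fun Z => ∑ e, ∑ k, if inc e k = u then
      (if UsesEdge Z e ∧ Sum.inl (inc e k) ∈ Z.verts then 1 else 0) else 0).sum := by
    refine congrArg Multiset.sum (Multiset.map_congr rfl fun Z hZ => ?_)
    by_cases hu : (Sum.inl u : BlowupVert d U E F) ∈ Z.verts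
    · obtain ⟨e, he⟩ := exists_usesEdge hd (hP Z hZ)
      obtain ⟨k, a, hk⟩ := he.mem_blowupVert (hP Z hZ) hu
      obtain ⟨-, rfl⟩ := (blowupVert_eq_inl inc).1 hk.symm
      rw [Finset.sum_eq_single e, Finset.sum_eq_single k]
      · simp [hu, he]
      · intro k' _ hk'
        rw [if_neg fun h => hk' (hinc e h)]
      · simp
      · intro e' _ he'
        have : ¬ UsesEdge Z e' := fun h => he' (h.eq (hP Z hZ) he)
        simp [this]
      · simp
    · rw [if_neg hu]
      symm
      refine Finset.sum_eq_zero fun e _ => Finset.sum_eq_zero fun k _ => ?_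
      split_ifs with h h'
      · exact absurd (h ▸ h'.2) hu
      · rfl
      · rfl
  rw [hcov, Multiset.sum_map_finset_sum]
  refine Finset.sum_congr rfl fun e _ => ?_
  rw [Multiset.sum_map_finset_sum]
  refine Finset.sum_congr rfl fun k _ => ?_
  split_ifs with h
  · exact (hq e k).symm
  · simp

lemma isCopy_induce_range {V : Type} {G : SimpleGraph V} {t : Fin d → V}
    (ht : ∀ k k', k ≠ k' → G.Adj (t k) (t k')) :
    IsCopy (⊤ : SimpleGraph (Fin d)) ((⊤ : G.Subgraph).induce (Set.range t)) := by
  have hinj : Function.Injective t := fun k k' h => by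
    by_contra hne
    exact G.ne_of_adj (ht k k' hne) h
  refine ⟨RelIso.symm ⟨Equiv.ofInjective t hinj, ?_⟩⟩
  intro k k'
  simp only [SimpleGraph.Subgraph.coe_adj, SimpleGraph.Subgraph.induce_adj,
    SimpleGraph.Subgraph.top_adj, SimpleGraph.top_adj]
  exact ⟨fun h hk => G.ne_of_adj h.2.2 (congrArg t hk), fun h => ⟨⟨k, rfl⟩, ⟨k', rfl⟩, ht k k' h⟩⟩

/-- A family of transversals of `d` copies of `F`: for fixed `x` and `j`, the positions in a fixed
class `k` run through all of `F` as `z` does. The indices `j < x` yield transversals that take the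
value `0` at most once, the others contain the constant transversal `0`, which is left out. -/
noncomputable def transversal (x j : ℕ) (z : F) (k : Fin d) : F :=
  if j < x then z + (k : ℕ) * ((j + 1 : ℕ) : F) else if (k : ℕ) = 0 then z else ((j + 1 : ℕ) : F) * z

/-- The indices of the transversals that are used. -/
def IsUsed (x j : ℕ) (z : F) : Prop := j < x ∨ z ≠ 0

section Transversal

variable {c : ℕ}

lemma succ_cast_ne_zero
    (hF : ∀ m n : ℕ, m ≤ d + c → n ≤ d + c → (m : F) = n → m = n)
    {j : ℕ} (hj : j < c) : ((j + 1 : ℕ) : F) ≠ 0 := fun h =>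
  Nat.succ_ne_zero j (hF (j + 1) 0 (by omega) (by omega) (by simpa using h))

lemma transversal_bijective
    (hF : ∀ m n : ℕ, m ≤ d + c → n ≤ d + c → (m : F) = n → m = n)
    {x j : ℕ} (hj : j < c) (k : Fin d) :
    Function.Bijective fun z : F => transversal x j z k := by
  unfold transversal
  split_ifs
  · exact (Equiv.addRight _).bijective
  · exact Function.bijective_id
  · exact mulLeft_bijective₀ _ (succ_cast_ne_zero hF hj)

lemma transversal_eq_zero_iff
    (hF : ∀ m n : ℕ, m ≤ d + c → n ≤ d + c → (m : F) = n → m = n)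
    {x j : ℕ} (hj : j < c) (hx : ¬ j < x) (k : Fin d) (z : F) :
    transversal x j z k = 0 ↔ z = 0 := by
  have := succ_cast_ne_zero hF hj
  simp only [transversal, if_neg hx]
  split_ifs
  · rfl
  · simp only [mul_eq_zero, this, false_or]

lemma transversal_ne_zero
    (hF : ∀ m n : ℕ, m ≤ d + c → n ≤ d + c → (m : F) = n → m = n)
    {x j : ℕ} {z : F} (hj : j < c) (hu : IsUsed x j z) {k k' : Fin d}
    (hk : k ≠ k') : transversal x j z k ≠ 0 ∨ transversal x j z k' ≠ 0 := by
  by_cases hx : j < x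
  · by_contra! h
    simp only [transversal, if_pos hx] at h
    have h1 : ((k : ℕ) : F) * ((j + 1 : ℕ) : F) = (k' : ℕ) * ((j + 1 : ℕ) : F) :=
      add_left_cancel (h.1.trans h.2.symm)
    have h2 := mul_right_cancel₀ (succ_cast_ne_zero hF hj) h1
    exact hk (Fin.ext (hF _ _ (by omega) (by omega) h2))
  · left
    rw [Ne, transversal_eq_zero_iff hF hj hx]
    exact hu.resolve_left hx

lemma transversal_injective
    (hF : ∀ m n : ℕ, m ≤ d + c → n ≤ d + c → (m : F) = n → m = n)
    (hd : 3 ≤ d) {x j j' : ℕ} {z z' : F} (hj : j < c) (hj' : j' < c)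
    (hu : IsUsed x j z)
    (h : ∀ k : Fin d, transversal x j z k = transversal x j' z' k) : j = j' ∧ z = z' := by
  have h0 := h ⟨0, by omega⟩
  have h1 := h ⟨1, by omega⟩
  have h2 := h ⟨2, by omega⟩
  have hne := succ_cast_ne_zero hF hj
  have hne' := succ_cast_ne_zero hF hj'
  have hcast : ((j + 1 : ℕ) : F) = ((j' + 1 : ℕ) : F) → j = j' := fun e => by
    have := hF _ _ (by omega) (by omega) e
    omega
  simp only [transversal, Nat.cast_zero, Nat.cast_one, Nat.cast_ofNat, zero_mul, add_zero, one_mul,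
    if_true, one_ne_zero, two_ne_zero, if_false, ite_self] at h0 h1 h2
  subst h0
  refine ⟨?_, rfl⟩
  split_ifs at h1 h2 with hx hx'
  · exact hcast (add_left_cancel h1)
  · exact absurd (by linear_combination h2 - h1) hne
  · exact absurd (by linear_combination h1 - h2) hne'
  · exact hcast (mul_right_cancel₀ (hu.resolve_left hx) h1)

lemma sum_transversal_eq [Fintype F]
    (hF : ∀ m n : ℕ, m ≤ d + c → n ≤ d + c → (m : F) = n → m = n)
    {x : ℕ} (hx : x ≤ c) (k : Fin d) (a : F) :
    (∑ j : Fin c, ∑ z : F, if IsUsed x j z ∧ transversal x j z k = a then 1 else 0) =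
      if a = 0 then x else c := by
  have hsum : ∀ j : Fin c, (∑ z : F, if IsUsed x j z ∧ transversal x j z k = a then 1 else 0) =
      if (j : ℕ) < x ∨ a ≠ 0 then 1 else 0 := by
    intro j
    obtain ⟨z₀, hz₀⟩ := (transversal_bijective hF (x := x) j.2 k).2 a
    have hz₀' : transversal x j z₀ k = a := hz₀
    have hiff : ∀ z : F, (IsUsed x j z ∧ transversal x j z k = a) ↔
        (z = z₀ ∧ ((j : ℕ) < x ∨ a ≠ 0)) := by
      intro z
      have key : transversal x j z k = a ↔ z = z₀ :=
        ⟨fun h => (transversal_bijective hF (x := x) j.2 k).1 (h.trans hz₀'.symm),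
          fun h => h ▸ hz₀'⟩
      rw [key, and_comm]
      refine and_congr_right fun h => ?_
      subst h
      by_cases hj : (j : ℕ) < x
      · simp [IsUsed, hj]
      · simp only [IsUsed, hj, false_or]
        rw [← hz₀', Ne, Ne, transversal_eq_zero_iff hF j.2 hj]
    simp only [hiff]
    split_ifs with h <;> simp [h]
  simp only [hsum]
  split_ifs with ha
  · simp only [ha, ne_eq, not_true_eq_false, or_false, Finset.sum_boole, Nat.cast_id]
    rw [Fin.card_filter_val_lt]
    exact min_eq_right hx
  · simp [ha]

end Transversal

/-- Every weighting of the hyperedges by numbers at most `c` comes from a set of copies of `K_d`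
in the blow-up that covers all private vertices exactly `c` times. -/
lemma exists_packing_of_weight [Fintype E] [Fintype F] (hd : 3 ≤ d)
    (hinc : ∀ e, Function.Injective (inc e)) {c : ℕ}
    (hF : ∀ m n : ℕ, m ≤ d + c → n ≤ d + c → (m : F) = n → m = n)
    {w : E → ℕ} (hw : ∀ e, w e ≤ c) :
    ∃ P : Finset (blowup F inc).Subgraph,
      (∀ Z ∈ P, IsCopy (⊤ : SimpleGraph (Fin d)) Z) ∧
      (∀ x, coverF P (Sum.inr x) = c) ∧ ∀ u, coverF P (Sum.inl u) = weightAt inc w u := by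
  let t : E × Fin c × F → Fin d → BlowupVert d U E F := fun y k =>
    blowupVert inc y.1 k (transversal (w y.1) y.2.1 y.2.2 k)
  let I : Finset (E × Fin c × F) := Finset.univ.filter fun y => IsUsed (w y.1) y.2.1 y.2.2
  let S : E × Fin c × F → (blowup F inc).Subgraph := fun y =>
    (⊤ : (blowup F inc).Subgraph).induce (Set.range (t y))
  have hI : ∀ y ∈ I, IsUsed (w y.1) y.2.1 y.2.2 := fun y hy => (Finset.mem_filter.1 hy).2
  have ht : ∀ y, Function.Injective (t y) := fun y k k' h => (blowupVert_inj hinc h).1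
  have hS : ∀ y v, v ∈ (S y).verts ↔ ∃ k, t y k = v := fun y v => by simp [S]
  have hSinj : Set.InjOn S I := by
    intro y hy y' _ h
    have hsub : ∀ k, ∃ k', t y' k' = t y k := fun k => by
      rw [← hS, ← h, hS]
      exact ⟨k, rfl⟩
    have hk : (⟨0, by omega⟩ : Fin d) ≠ ⟨1, by omega⟩ := by simp
    have he : y'.1 = y.1 := by
      rcases transversal_ne_zero hF y.2.1.2 (hI y hy) hk with h0 | h0
      all_goals
        obtain ⟨k', hk'⟩ := hsub _
        simp only [t] at hk'
        rw [blowupVert_of_ne inc _ _ h0, blowupVert_eq_inr] at hk'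
        exact hk'.1
    obtain ⟨e, j, z⟩ := y
    obtain ⟨e', j', z'⟩ := y'
    obtain rfl : e' = e := he
    have := transversal_injective hF hd j.2 j'.2 (hI _ hy) fun k => by
      obtain ⟨k', hk'⟩ := hsub k
      obtain ⟨rfl, h⟩ := blowupVert_inj hinc hk'
      exact h.symm
    exact Prod.ext rfl (Prod.ext (Fin.ext this.1) this.2)
  have hcover : ∀ v, coverF (I.image S) v = ∑ e, ∑ k, ∑ a : F,
      if blowupVert inc e k a = v then (if a = 0 then w e else c) else 0 := by
    intro v
    have h1 : coverF (I.image S) v = ∑ y ∈ I, if v ∈ (S y).verts then 1 else 0 :=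
      Finset.sum_image (f := fun Z : (blowup F inc).Subgraph => if v ∈ Z.verts then 1 else 0) hSinj
    have h2 : ∀ y, (if v ∈ (S y).verts then 1 else 0) = ∑ k, if t y k = v then 1 else 0 := by
      intro y
      rw [hS]
      split_ifs with h
      · obtain ⟨k, rfl⟩ := h
        simp [(ht y).eq_iff]
      · push Not at h
        simp [h]
    have h3 : ∀ e k j z, (if IsUsed (w e) (j : Fin c) z then
        (if t (e, j, z) k = v then 1 else 0) else 0) = ∑ a : F, if blowupVert inc e k a = v then
          (if IsUsed (w e) j z ∧ transversal (w e) j z k = a then 1 else 0) else 0 := by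
      intro e k j z
      rw [Finset.sum_eq_single (transversal (w e) j z k)]
      · by_cases hu : IsUsed (w e) (j : Fin c) z <;> simp [t, hu]
      · intro b _ hb
        simp [hb.symm]
      · simp
    rw [h1, Finset.sum_filter, Fintype.sum_prod_type]
    refine Finset.sum_congr rfl fun e _ => ?_
    rw [Fintype.sum_prod_type]
    simp only [h2]
    calc _ = ∑ j : Fin c, ∑ z : F, ∑ k, ∑ a : F, if blowupVert inc e k a = v then
          (if IsUsed (w e) j z ∧ transversal (w e) j z k = a then 1 else 0) else 0 := by
          refine Finset.sum_congr rfl fun j _ => Finset.sum_congr rfl fun z _ => ?_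
          simp only [← h3]
          split_ifs <;> simp
      _ = ∑ j : Fin c, ∑ k, ∑ a : F, ∑ z : F, if blowupVert inc e k a = v then
          (if IsUsed (w e) j z ∧ transversal (w e) j z k = a then 1 else 0) else 0 := by
          refine Finset.sum_congr rfl fun j _ => ?_
          rw [Finset.sum_comm]
          exact Finset.sum_congr rfl fun k _ => Finset.sum_comm
      _ = ∑ k, ∑ a : F, ∑ j : Fin c, ∑ z : F, if blowupVert inc e k a = v then
          (if IsUsed (w e) j z ∧ transversal (w e) j z k = a then 1 else 0) else 0 := by
          rw [Finset.sum_comm]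
          exact Finset.sum_congr rfl fun k _ => Finset.sum_comm
      _ = _ := by
          refine Finset.sum_congr rfl fun k _ => Finset.sum_congr rfl fun a _ => ?_
          rw [← sum_transversal_eq hF (hw e) k a]
          split_ifs <;> simp
  refine ⟨I.image S, ?_, ?_, ?_⟩
  · intro Z hZ
    obtain ⟨y, hy, rfl⟩ := Finset.mem_image.1 hZ
    refine isCopy_induce_range fun k k' hk => ⟨y.1, k, _, k', _, hk, ?_, rfl, rfl⟩
    exact transversal_ne_zero hF y.2.1.2 (hI y hy) hk
  · rintro ⟨e, k, a, ha⟩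
    rw [hcover, Finset.sum_eq_single e, Finset.sum_eq_single k, Finset.sum_eq_single a]
    · simp [blowupVert_eq_inr, ha]
    all_goals simp +contextual [blowupVert_eq_inr]
  · intro u
    rw [hcover]
    refine Finset.sum_congr rfl fun e _ => Finset.sum_congr rfl fun k _ => ?_
    rw [Finset.sum_eq_single 0]
    · simp
    · intro b _ hb
      simp [blowupVert_eq_inl, hb]
    · simp

end Blowup

/-- For complete graphs every gadget is coherent: a clique through an internal vertex consists of
neighbours of that vertex. -/
lemma coherent_top {d c ℓ : ℕ} {V : Type} (G : SimpleGraph V) (portals : Fin ℓ → V) :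
    Coherent (⊤ : SimpleGraph (Fin d)) c G portals := by
  rintro W E ι - - hι P hP Z hZ ⟨v, hv, hvZ⟩ u hu
  by_cases h : ι v = u
  · exact ⟨v, h⟩
  · exact hι v hv u ((hP.1 Z hZ).adj hvZ hu h)

/-- The relation defined by the weightings of a `d`-uniform hypergraph that have total weight `c` at
all vertices except the portals is strictly realized by a blow-up. -/
theorem exists_gadget_of_hypergraph {c d ℓ : ℕ} (hd : 3 ≤ d) {U E : Type} [Fintype U]
    [Fintype E] (inc : E → Fin d → U) (hinc : ∀ e, Function.Injective (inc e))
    (port : Fin ℓ → U) (hport : Function.Injective port) (R : Set (Fin ℓ → ℕ))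
    (hR : ∀ r : Fin ℓ → ℕ, (∀ i, r i ≤ c) → (r ∈ R ↔ ∃ w : E → ℕ,
      (∀ i, weightAt inc w (port i) = r i) ∧ ∀ u ∉ Set.range port, weightAt inc w u = c)) :
    ∃ (V : Type) (_ : Fintype V) (G : SimpleGraph V) (portals : Fin ℓ → V),
      Function.Injective portals ∧ Coherent (⊤ : SimpleGraph (Fin d)) c G portals ∧
      StrictRealizes (⊤ : SimpleGraph (Fin d)) c G portals R := by
  obtain ⟨p, hp, hprime⟩ := Nat.exists_infinite_primes (d + c + 1)
  have : Fact p.Prime := ⟨hprime⟩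
  have hF : ∀ m n : ℕ, m ≤ d + c → n ≤ d + c → (m : ZMod p) = n → m = n := by
    intro m n hm hn h
    rwa [ZMod.natCast_eq_natCast_iff', Nat.mod_eq_of_lt (by omega),
      Nat.mod_eq_of_lt (by omega)] at h
  let portals : Fin ℓ → BlowupVert d U E (ZMod p) := fun i => Sum.inl (port i)
  have hdist : ∀ r : Fin ℓ → ℕ, (∀ i, r i ≤ c) → r ∈ R →
      ∃ P : Finset (blowup (ZMod p) inc).Subgraph,
        (∀ Z ∈ P, IsCopy (⊤ : SimpleGraph (Fin d)) Z) ∧ (∀ v, coverF P v ≤ c) ∧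
        (∀ v, v ∉ Set.range portals → coverF P v = c) ∧
        ∀ i, coverF P (portals i) = r i := by
    intro r hr hrR
    obtain ⟨w, hw, hw'⟩ := (hR r hr).1 hrR
    have hle : ∀ u, weightAt inc w u ≤ c := by
      intro u
      by_cases hu : u ∈ Set.range port
      · obtain ⟨i, rfl⟩ := hu
        exact (hw i).trans_le (hr i)
      · exact (hw' u hu).le
    have hwc : ∀ e, w e ≤ c := by
      intro e
      let k : Fin d := ⟨0, by omega⟩
      refine le_trans ?_ (hle (inc e k))
      calc w e = if inc e k = inc e k then w e else 0 := by simp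
        _ ≤ ∑ k', if inc e k' = inc e k then w e else 0 :=
          Finset.single_le_sum (f := fun k' => if inc e k' = inc e k then w e else 0)
            (fun _ _ => Nat.zero_le _) (Finset.mem_univ k)
        _ ≤ _ := Finset.single_le_sum
          (f := fun e' => ∑ k', if inc e' k' = inc e k then w e' else 0)
            (fun _ _ => Nat.zero_le _) (Finset.mem_univ e)
    obtain ⟨P, hP, hin, hout⟩ := exists_packing_of_weight hd hinc hF hwc
    refine ⟨P, hP, ?_, ?_, fun i => (hout _).trans (hw i)⟩
    · rintro (u | x)
      · exact (hout u).trans_le (hle u)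
      · exact (hin x).le
    · rintro (u | x) hv
      · refine (hout u).trans (hw' u ?_)
        rintro ⟨i, rfl⟩
        exact hv ⟨i, rfl⟩
      · exact hin x
  have harb : ∀ r : Fin ℓ → ℕ, (∀ i, r i ≤ c) → ∀ P : Multiset (blowup (ZMod p) inc).Subgraph,
      (∀ Z ∈ P, IsCopy (⊤ : SimpleGraph (Fin d)) Z) →
      (∀ v, v ∉ Set.range portals → coverM P v = c) → (∀ i, coverM P (portals i) = r i) →
      r ∈ R := by
    intro r hr P hP hin hout
    obtain ⟨w, hw⟩ := exists_weight_of_packing (by omega) hinc P hP fun x =>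
      hin (Sum.inr x) (by rintro ⟨i, hi⟩; cases hi)
    refine (hR r hr).2 ⟨w, fun i => (hw _).symm.trans (hout i), fun u hu => ?_⟩
    refine (hw u).symm.trans (hin _ ?_)
    rintro ⟨i, hi⟩
    exact hu ⟨i, Sum.inl_injective hi⟩
  refine ⟨BlowupVert d U E (ZMod p), inferInstance, blowup (ZMod p) inc, portals,
    fun i j h => hport (Sum.inl_injective h), coherent_top _ _, fun r hr => ⟨hdist r hr, ?_⟩,
    fun r hr => ⟨fun h => ?_, ?_⟩⟩
  · rintro ⟨P, hP, -, hin, hout⟩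
    exact harb r hr P.val hP hin hout
  · obtain ⟨P, hP⟩ := hdist r hr h
    exact ⟨P.val, hP⟩
  · rintro ⟨P, hP, -, hin, hout⟩
    exact harb r hr P hP hin hout

section Net

variable {n : ℕ} {Γ T : Type}

/-- A permutation of the groups, applied only in one of the positions. -/
def linkPerm (σ : Equiv.Perm Γ) (a : Fin n) (b : Fin (n + 1)) : Equiv.Perm Γ :=
  if (a : ℕ) = 0 ∧ (b : ℕ) = 0 then σ else Equiv.refl Γ

/-- A hypergraph in which each group `g : Γ` has `n + 1` positive edges, each with one terminal
given by `t` and `n` links, and `n` negative edges consisting of links only. Every link lies in one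
positive and one negative edge, of the same group or of groups related by `σ`. -/
def netInc (σ : Equiv.Perm Γ) (t : Γ → Fin (n + 1) → T) :
    (Γ × Fin (n + 1)) ⊕ (Γ × Fin n) → Fin (n + 1) → T ⊕ (Γ × Fin n × Fin (n + 1))
  | Sum.inl (g, b) => Fin.cons (Sum.inl (t g b)) fun a => Sum.inr (linkPerm σ a b g, a, b)
  | Sum.inr (g, a) => fun b => Sum.inr (g, a, b)

variable (σ : Equiv.Perm Γ) (t : Γ → Fin (n + 1) → T)

lemma netInc_injective (e) : Function.Injective (netInc σ t e) := by
  rcases e with ⟨g, b⟩ | ⟨g, a⟩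
  · rw [netInc, Fin.cons_injective_iff]
    refine ⟨by simp, fun a a' h => ?_⟩
    simp only [Sum.inr.injEq, Prod.mk.injEq] at h
    exact h.2.1
  · intro b b' h
    simpa [netInc] using h

variable [Fintype Γ]

lemma weightAt_netInc_terminal (w : (Γ × Fin (n + 1)) ⊕ (Γ × Fin n) → ℕ) (τ : T) :
    weightAt (netInc σ t) w (Sum.inl τ) =
      ∑ g, ∑ b, if t g b = τ then w (Sum.inl (g, b)) else 0 := by
  simp [weightAt, netInc, Fintype.sum_sum_type, Fintype.sum_prod_type, Fin.sum_univ_succ]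

lemma weightAt_netInc_link (w : (Γ × Fin (n + 1)) ⊕ (Γ × Fin n) → ℕ) (g : Γ) (a : Fin n)
    (b : Fin (n + 1)) :
    weightAt (netInc σ t) w (Sum.inr (g, a, b)) =
      w (Sum.inl ((linkPerm σ a b).symm g, b)) + w (Sum.inr (g, a)) := by
  rw [weightAt, Fintype.sum_sum_type]
  congr 1
  · rw [Finset.sum_eq_single ((linkPerm σ a b).symm g, b), Finset.sum_eq_single a.succ]
    · simp [netInc]
    · intro k _ hk
      refine Fin.cases ?_ (fun a' hk => ?_) k hk
      · simp [netInc]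
      · have : a' ≠ a := fun h => hk (by rw [h])
        simp [netInc, this]
    · simp
    · rintro ⟨g', b'⟩ _ hne
      refine Finset.sum_eq_zero fun k _ => if_neg ?_
      refine Fin.cases ?_ (fun a' => ?_) k
      · simp [netInc]
      · simp only [netInc, Fin.cons_succ, Sum.inr.injEq, Prod.mk.injEq, not_and]
        rintro h rfl rfl
        exact hne (by rw [← h, Equiv.symm_apply_apply])
    · simp
  · rw [Finset.sum_eq_single (g, a), Finset.sum_eq_single b]
    · simp [netInc]
    · intro b' _ hb
      simp [netInc, hb]
    · simp
    · rintro ⟨g', a'⟩ _ hne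
      refine Finset.sum_eq_zero fun k _ => if_neg ?_
      simp only [netInc, Sum.inr.injEq, Prod.mk.injEq, not_and]
      rintro rfl rfl
      exact absurd rfl hne
    · simp

/-- The weightings of the net assign the same weight to all positive edges of a group and of groups
related by `σ`. -/
lemma exists_weight_netInc_iff (hn : 2 ≤ n) (c : ℕ) (f : T → ℕ) :
    (∃ w, (∀ τ, weightAt (netInc σ t) w (Sum.inl τ) = f τ) ∧
        ∀ x, weightAt (netInc σ t) w (Sum.inr x) = c) ↔
      ∃ y : Γ → ℕ, (∀ g, y (σ g) = y g) ∧ (∀ g, y g ≤ c) ∧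
        ∀ τ, (∑ g, ∑ b, if t g b = τ then y g else 0) = f τ := by
  constructor
  · rintro ⟨w, hw, hlink⟩
    have hl : ∀ g a b, w (Sum.inl ((linkPerm σ a b).symm g, b)) + w (Sum.inr (g, a)) = c :=
      fun g a b => (weightAt_netInc_link σ t w g a b).symm.trans (hlink (g, a, b))
    have heq : ∀ g b, w (Sum.inl (g, b)) + w (Sum.inr (g, ⟨1, by omega⟩)) = c := fun g b => by
      simpa [linkPerm] using hl g ⟨1, by omega⟩ b
    have hzero : ∀ g, w (Sum.inl (g, 0)) + w (Sum.inr (σ g, ⟨0, by omega⟩)) = c := fun g => by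
      simpa [linkPerm] using hl (σ g) ⟨0, by omega⟩ 0
    have hlast : ∀ g, w (Sum.inl (g, Fin.last n)) + w (Sum.inr (g, ⟨0, by omega⟩)) = c :=
      fun g => by
        have : n ≠ 0 := by omega
        simpa [linkPerm, this] using hl g ⟨0, by omega⟩ (Fin.last n)
    have hconst : ∀ g b, w (Sum.inl (g, b)) = w (Sum.inl (g, 0)) := fun g b => by
      have := heq g b
      have := heq g 0
      omega
    refine ⟨fun g => w (Sum.inl (g, 0)), fun g => ?_, fun g => ?_, fun τ => ?_⟩
    · have := hzero g
      have := hlast (σ g)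
      have := hconst (σ g) (Fin.last n)
      beta_reduce
      omega
    · have := heq g 0
      beta_reduce
      omega
    · rw [← hw, weightAt_netInc_terminal]
      simp only [hconst _ _]
  · rintro ⟨y, hσ, hc, hy⟩
    refine ⟨Sum.elim (fun x => y x.1) fun x => c - y x.1, fun τ => ?_, ?_⟩
    · rw [weightAt_netInc_terminal, ← hy]
      rfl
    · rintro ⟨g, a, b⟩
      have : y ((linkPerm σ a b).symm g) = y g := by
        unfold linkPerm
        split_ifs
        · rw [← hσ, Equiv.apply_symm_apply]
        · rfl
      rw [weightAt_netInc_link]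
      simp only [Sum.elim_inl, Sum.elim_inr, this]
      exact Nat.add_sub_cancel' (hc g)

end Net

lemma eq_of_finRotate_invariant {m : ℕ} {f : Fin m → ℕ} (hf : ∀ g, f (finRotate m g) = f g)
    (g g' : Fin m) : f g = f g' := by
  obtain _ | m := m
  · exact g.elim0
  · have h0 : ∀ g, f g = f 0 := by
      intro g
      induction g using Fin.induction with
      | zero => rfl
      | succ i ih => rw [← ih, ← hf i.castSucc, finRotate_apply, Fin.coeSucc_eq_succ]
    rw [h0 g, h0 g']

lemma exists_eq_one_of_sum_eq_one {ι : Type} [Fintype ι] {z : ι → ℕ} (h : ∑ x, z x = 1) :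
    ∃ x, z x = 1 ∧ ∀ y ≠ x, z y = 0 := by
  obtain ⟨x, -, hx⟩ := Finset.exists_ne_zero_of_sum_ne_zero (h.trans_ne one_ne_zero)
  have hadd := Finset.add_sum_erase Finset.univ z (Finset.mem_univ x)
  have hrest : ∑ y ∈ Finset.univ.erase x, z y = 0 := by omega
  exact ⟨x, by omega, fun y hy => Finset.sum_eq_zero_iff.1 hrest y (by simp [hy])⟩

/-- There is a map on `Fin q × Fin d` with any prescribed fibre sizes summing to `q * d`. -/
lemma exists_fibres {T : Type} [Fintype T] {q d : ℕ} (μ : T → ℕ) (h : ∑ τ, μ τ = q * d) :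
    ∃ t : Fin q → Fin d → T, ∀ τ y, (∑ g, ∑ b, if t g b = τ then y else 0) = y * μ τ := by
  have hcard : Fintype.card (Fin q × Fin d) = Fintype.card (Σ τ, Fin (μ τ)) := by simp [h]
  let φ := Fintype.equivOfCardEq hcard
  refine ⟨fun g b => (φ (g, b)).1, fun τ y => ?_⟩
  rw [← Fintype.sum_prod_type' (f := fun g b => if (φ (g, b)).1 = τ then y else 0),
    φ.sum_comp (fun x => if x.1 = τ then y else 0), Fintype.sum_sigma,
    Finset.sum_eq_single τ (fun τ' _ h => by simp [h]) (by simp)]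
  simp [mul_comm]

lemma sum_sigma_fibres {Λ T : Type} [Fintype Λ] {q : Λ → ℕ} {d : ℕ}
    {t : (r : Λ) → Fin (q r) → Fin d → T} {μ : Λ → T → ℕ}
    (ht : ∀ r τ y, (∑ g, ∑ b, if t r g b = τ then y else 0) = y * μ r τ) (z : Λ → ℕ) (τ : T) :
    (∑ x : Σ r, Fin (q r), ∑ b, if t x.1 x.2 b = τ then z x.1 else 0) = ∑ r, z r * μ r τ := by
  rw [Fintype.sum_sigma]
  exact Finset.sum_congr rfl fun r _ => ht r τ (z r)

/-- Every `(0,d)`-regular relation is strictly realized by a coherent gadget. -/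
theorem exists_gadget_of_regular {c d ℓ : ℕ} (hc : 1 ≤ c) (hd : 3 ≤ d) (R : Set (Fin ℓ → ℕ))
    (hRd : ∀ r ∈ R, d ∣ ∑ i, r i) :
    ∃ (V : Type) (_ : Fintype V) (G : SimpleGraph V) (portals : Fin ℓ → V),
      Function.Injective portals ∧ Coherent (⊤ : SimpleGraph (Fin d)) c G portals ∧
      StrictRealizes (⊤ : SimpleGraph (Fin d)) c G portals R := by
  obtain ⟨n, rfl⟩ : ∃ n, d = n + 1 := ⟨d - 1, by omega⟩
  let Λ : Type := {r : Fin ℓ → Fin (c + 1) // (fun i => (r i : ℕ)) ∈ R}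
  let μ : Λ → Fin ℓ ⊕ Fin (n + 1) → ℕ := fun r => Sum.elim (fun i => (r.1 i : ℕ)) fun _ => c
  let q : Λ → ℕ := fun r => (∑ i, (r.1 i : ℕ)) / (n + 1) + c
  have hμ : ∀ r, ∑ τ, μ r τ = q r * (n + 1) := by
    intro r
    simp only [μ, q, Fintype.sum_sum_type, Sum.elim_inl, Sum.elim_inr, add_mul,
      Nat.div_mul_cancel (hRd _ r.2)]
    simp [mul_comm]
  choose t ht using fun r => exists_fibres (μ r) (hμ r)
  let σ : Equiv.Perm (Σ r, Fin (q r)) := Equiv.sigmaCongrRight fun r => finRotate (q r)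
  have hsum := sum_sigma_fibres ht
  refine exists_gadget_of_hypergraph hd (netInc σ fun x b => t x.1 x.2 b) (netInc_injective _ _)
    (fun i => Sum.inl (Sum.inl i)) (fun i j h => Sum.inl_injective (Sum.inl_injective h)) R
    fun r hr => ?_
  have hiff := exists_weight_netInc_iff σ (fun x b => t x.1 x.2 b) (by omega) c
    (Sum.elim r fun _ => c)
  constructor
  · intro hrR
    let r₀ : Λ := ⟨fun i => ⟨r i, Nat.lt_succ_of_le (hr i)⟩, hrR⟩
    let z : Λ → ℕ := fun x => if x = r₀ then 1 else 0
    have hz : ∀ x, z x ≤ c := fun x => by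
      simp only [z]
      split_ifs <;> omega
    have hzsum : ∀ τ, ∑ x, z x * μ x τ = Sum.elim r (fun _ => c) τ := by
      intro τ
      rw [Finset.sum_eq_single r₀ (fun x _ hx => by simp [z, hx]) (by simp)]
      rcases τ with i | s <;> simp [z, μ, r₀]
    obtain ⟨w, hw, hw'⟩ := hiff.2
      ⟨fun x => z x.1, fun x => rfl, fun x => hz x.1, fun τ => (hsum z τ).trans (hzsum τ)⟩
    refine ⟨w, fun i => hw (Sum.inl i), ?_⟩
    rintro ((i | s) | x) hu
    · exact absurd ⟨i, rfl⟩ hu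
    · exact hw (Sum.inr s)
    · exact hw' x
  · rintro ⟨w, hw, hw'⟩
    obtain ⟨y, hσ, -, hy⟩ := hiff.1 ⟨w, by
      rintro (i | s)
      · exact hw i
      · exact hw' _ (by rintro ⟨i, hi⟩; cases hi), fun x => hw' _ (by rintro ⟨i, hi⟩; cases hi)⟩
    have hq : ∀ r, 0 < q r := fun r => Nat.add_pos_right _ hc
    let z : Λ → ℕ := fun r => y ⟨r, ⟨0, hq r⟩⟩
    have hyz : y = fun x => z x.1 := funext fun x =>
      eq_of_finRotate_invariant (f := fun g => y ⟨x.1, g⟩) (fun g => hσ ⟨x.1, g⟩) _ _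
    replace hy : ∀ τ, ∑ r, z r * μ r τ = Sum.elim r (fun _ => c) τ := fun τ => by
      rw [← hy τ, hyz]
      exact (hsum z τ).symm
    have hz : ∑ r, z r = 1 := by
      have := hy (Sum.inr 0)
      simp only [μ, Sum.elim_inr, ← Finset.sum_mul] at this
      exact Nat.eq_of_mul_eq_mul_right hc (this.trans (one_mul c).symm)
    obtain ⟨r₀, hone, hzero⟩ := exists_eq_one_of_sum_eq_one hz
    have hr₀ : (fun i => (r₀.1 i : ℕ)) = r := by
      funext i
      rw [← show _ = r i from hy (Sum.inl i),
        Finset.sum_eq_single r₀ (fun x _ hx => by simp [hzero x hx]) (by simp), hone]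
      simp [μ]
    exact hr₀ ▸ r₀.2

/-- For `c ≥ 1`, `d ≥ 3`, `H = K_d` and `ℓ ≥ 1` there is a bound `N`
such that every `(0,d)`-regular relation `R ⊆ {0,…,c}^ℓ` is strictly `(c,H)`-realized by
some `(c,H)`-coherent gadget with `ℓ` portal vertices and at most `N` vertices. -/
theorem statement8 (c d ℓ : ℕ) (hc : 1 ≤ c) (hd : 3 ≤ d) (hl : 1 ≤ ℓ) :
    ∃ N : ℕ, ∀ R : Set (Fin ℓ → ℕ),
      (∀ r ∈ R, ∀ i, r i ≤ c) →
      (∀ r ∈ R, d ∣ ∑ i, r i) →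
      ∃ (V : Type) (_ : Fintype V) (G : SimpleGraph V) (portals : Fin ℓ → V),
        Function.Injective portals ∧
        Coherent (⊤ : SimpleGraph (Fin d)) c G portals ∧
        StrictRealizes (⊤ : SimpleGraph (Fin d)) c G portals R ∧
        Fintype.card V ≤ N := by
  let Good : Set (Set (Fin ℓ → ℕ)) := {R | (∀ r ∈ R, ∀ i, r i ≤ c) ∧ ∀ r ∈ R, d ∣ ∑ i, r i}
  have hfin : Good.Finite := by
    refine (Set.Finite.finite_subsets (Set.finite_Iic fun _ : Fin ℓ => c)).subset ?_
    exact fun R hR r hr => hR.1 r hr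
  choose! V hV G portals h using fun R (hR : R ∈ Good) =>
    exists_gadget_of_regular hc hd R hR.2
  obtain ⟨N, hN⟩ := (hfin.image fun R => Nat.card (V R)).bddAbove
  refine ⟨N, fun R hRc hRd => ?_⟩
  have hR : R ∈ Good := ⟨hRc, hRd⟩
  obtain ⟨hinj, hcoh, hreal⟩ := h R hR
  refine ⟨V R, hV R hR, G R, portals R hR, hinj, hcoh, hreal, ?_⟩
  exact (@Nat.card_eq_fintype_card _ (hV R hR)).symm.trans_le (hN ⟨R, hR, rfl⟩)
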